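/- Let C be a convex, max-closed and bounded subset of L0+. Then C^osp is nonempty, and C^osp is dense in C^max with respect to the topology of convergence in probability (every element of C^max is the limit in probability of a sequence of outer support points of C). -/

import Mathlib

open MeasureTheory Filter Set

noncomputable section

variable {Ω : Type*} [MeasurableSpace Ω]

/-- The nonnegative orthant `L⁰₊` of the space `L⁰` of (a.e.-equivalence classes of)
random variables over `(Ω, ℱ, P)`. -/
def L0plus (P : Measure Ω) : Set (Ω →ₘ[P] ℝ) := {f | 0 ≤ f}

/-- The metric `(f, g) ↦ E[1 ∧ |f - g|]` inducing the topology of convergence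
in probability on `L⁰`. -/
def dist0 (P : Measure Ω) (f g : Ω →ₘ[P] ℝ) : ℝ :=
  ∫ ω, min 1 |f ω - g ω| ∂P

/-- Convergence in probability of a sequence in `L⁰`. -/
def Tendsto0 (P : Measure Ω) (f : ℕ → Ω →ₘ[P] ℝ) (g : Ω →ₘ[P] ℝ) : Prop :=
  Tendsto (fun n => dist0 P (f n) g) atTop (nhds 0)

/-- Closure of a set in `L⁰` with respect to the topology of convergence in probability. -/
def closure0 (P : Measure Ω) (C : Set (Ω →ₘ[P] ℝ)) : Set (Ω →ₘ[P] ℝ) :=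
  {f | ∀ ε : ℝ, 0 < ε → ∃ g ∈ C, dist0 P f g < ε}

/-- A set of `L⁰` is closed iff it contains its closure. -/
def IsClosed0 (P : Measure Ω) (C : Set (Ω →ₘ[P] ℝ)) : Prop :=
  closure0 P C ⊆ C

/-- Boundedness (in probability) of a set `C ⊆ L⁰₊` : `lim_{ℓ → ∞} sup_{f ∈ C} P[f > ℓ] = 0`. -/
def Bounded0 (P : Measure Ω) (C : Set (Ω →ₘ[P] ℝ)) : Prop :=
  Tendsto (fun ℓ : ℝ => ⨆ f ∈ C, P {ω | ℓ < f ω}) atTop (nhds 0)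

/-- The set `C^max` of maximal elements of `C ⊆ L⁰₊` : `f ∈ C` such that `f ≤ g` a.s.
and `g ∈ C` imply `f = g` a.s. -/
def maxSet (P : Measure Ω) (C : Set (Ω →ₘ[P] ℝ)) : Set (Ω →ₘ[P] ℝ) :=
  {f | f ∈ C ∧ ∀ g ∈ C, f ≤ g → f = g}

/-- `C` is max-closed if every maximal element of its closure already belongs to `C`. -/
def MaxClosed (P : Measure Ω) (C : Set (Ω →ₘ[P] ℝ)) : Prop :=
  maxSet P (closure0 P C) ⊆ C

/-- The pairing `⟨μ, f⟩ = ∫ f dμ ∈ [0, ∞]` between a nonnegative measure `μ` and `f ∈ L⁰₊`. -/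
def pairing {P : Measure Ω} (μ : Measure Ω) (f : Ω →ₘ[P] ℝ) : ENNReal :=
  ∫⁻ ω, ENNReal.ofReal (f ω) ∂μ

/-- The set `C^osp` of outer support points of `C ⊆ L⁰₊`: points `g ∈ C^max` for which there
is a σ-finite nonnegative measure `μ ≪ P` with `0 < sup_{f ∈ C} ⟨μ, f⟩ = ⟨μ, g⟩ < ∞`;
by convention `{0}^osp = {0}`. -/
def osp (P : Measure Ω) (C : Set (Ω →ₘ[P] ℝ)) : Set (Ω →ₘ[P] ℝ) :=
  {g | g ∈ maxSet P C ∧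
    (C = {0} ∨ ∃ μ : Measure Ω, μ ≪ P ∧ SigmaFinite μ ∧
      0 < pairing μ g ∧ pairing μ g < ⊤ ∧ (⨆ f ∈ C, pairing μ f) = pairing μ g)}

/-- The solid hull of `C ⊆ L⁰₊`. -/
def solidHull (P : Measure Ω) (C : Set (Ω →ₘ[P] ℝ)) : Set (Ω →ₘ[P] ℝ) :=
  {f | f ∈ L0plus P ∧ ∃ g ∈ C, f ≤ g}

/-- A set `S ⊆ L⁰₊` is solid if `g ∈ S` and `0 ≤ f ≤ g` imply `f ∈ S`. -/
def Solid (P : Measure Ω) (S : Set (Ω →ₘ[P] ℝ)) : Prop :=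
  ∀ g ∈ S, ∀ f : Ω →ₘ[P] ℝ, 0 ≤ f → f ≤ g → f ∈ S

/-- `(g n)` is a sequence of forward convex combinations of `(f n)`. -/
def ForwardConvexComb (P : Measure Ω) (f g : ℕ → Ω →ₘ[P] ℝ) : Prop :=
  ∀ n : ℕ, g n ∈ convexHull ℝ (f '' Set.Ici n)

end


section MetricLemmas

variable {Ω : Type*} [MeasurableSpace Ω] {P : Measure Ω}

theorem min_one_add_le {a b c : ℝ} (h : a ≤ b + c) (hb : 0 ≤ b) (hc : 0 ≤ c) :
    min 1 a ≤ min 1 b + min 1 c := by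
  rcases le_total 1 b with h1 | h1 <;> rcases le_total 1 c with h2 | h2 <;>
    rcases le_total 1 a with h3 | h3 <;> simp [h1, h2, h3] <;> linarith

theorem integrable_of_measurable_of_le [IsFiniteMeasure P] {F : Ω → ℝ} (hF : Measurable F) (c : ℝ)
    (h : ∀ ω, |F ω| ≤ c) : Integrable F P :=
  Integrable.of_bound hF.aestronglyMeasurable c (ae_of_all _ h)

theorem integrable_min_one_abs_sub [IsFiniteMeasure P] (f g : Ω →ₘ[P] ℝ) :
    Integrable (fun ω => min 1 |f ω - g ω|) P := by
  refine integrable_of_measurable_of_le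
    (measurable_const.min (f.measurable.sub g.measurable).abs) 1 fun ω => ?_
  rw [abs_of_nonneg (le_min zero_le_one (abs_nonneg _))]
  exact min_le_left _ _

theorem dist0_self (f : Ω →ₘ[P] ℝ) : dist0 P f f = 0 := by
  simp [dist0]

theorem dist0_triangle [IsFiniteMeasure P] (f g h : Ω →ₘ[P] ℝ) :
    dist0 P f h ≤ dist0 P f g + dist0 P g h := by
  unfold dist0
  rw [← integral_add (integrable_min_one_abs_sub f g) (integrable_min_one_abs_sub g h)]
  refine integral_mono (integrable_min_one_abs_sub f h)
    ((integrable_min_one_abs_sub f g).add (integrable_min_one_abs_sub g h)) fun ω => ?_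
  exact min_one_add_le (abs_sub_le _ _ _) (abs_nonneg _) (abs_nonneg _)

theorem coeFn_combo (a b : ℝ) (f g : Ω →ₘ[P] ℝ) :
    ∀ᵐ ω ∂P, (a • f + b • g : Ω →ₘ[P] ℝ) ω = a * f ω + b * g ω := by
  filter_upwards [AEEqFun.coeFn_add (a • f) (b • g), AEEqFun.coeFn_smul a f,
    AEEqFun.coeFn_smul b g] with ω h1 h2 h3
  rw [h1, Pi.add_apply, h2, h3]
  simp

theorem dist0_combo_le [IsFiniteMeasure P] {a b : ℝ} (ha : 0 ≤ a) (hb : 0 ≤ b) (hab : a + b = 1)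
    (f g f' g' : Ω →ₘ[P] ℝ) :
    dist0 P (a • f + b • g) (a • f' + b • g') ≤ dist0 P f f' + dist0 P g g' := by
  unfold dist0
  rw [← integral_add (integrable_min_one_abs_sub f f') (integrable_min_one_abs_sub g g')]
  refine integral_mono_ae (integrable_min_one_abs_sub _ _)
    ((integrable_min_one_abs_sub f f').add (integrable_min_one_abs_sub g g')) ?_
  filter_upwards [coeFn_combo a b f g, coeFn_combo a b f' g'] with ω h1 h2
  simp only [h1, h2]
  refine min_one_add_le ?_ (abs_nonneg _) (abs_nonneg _)
  have : a * f ω + b * g ω - (a * f' ω + b * g' ω) = a * (f ω - f' ω) + b * (g ω - g' ω) := by ring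
  rw [this]
  refine (abs_add_le _ _).trans (add_le_add ?_ ?_)
  · rw [abs_mul, abs_of_nonneg ha]
    exact mul_le_of_le_one_left (abs_nonneg _) (by linarith)
  · rw [abs_mul, abs_of_nonneg hb]
    exact mul_le_of_le_one_left (abs_nonneg _) (by linarith)

theorem tendsto_dist0_of_ae_tendsto [IsFiniteMeasure P] {f : ℕ → Ω →ₘ[P] ℝ} {g : Ω →ₘ[P] ℝ}
    (h : ∀ᵐ ω ∂P, Tendsto (fun n => f n ω) atTop (nhds (g ω))) :
    Tendsto (fun n => dist0 P (f n) g) atTop (nhds 0) := by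
  have h0 : (0 : ℝ) = ∫ _, (0 : ℝ) ∂P := by simp
  rw [h0]
  refine tendsto_integral_of_dominated_convergence (fun _ => 1)
    (fun n => (integrable_min_one_abs_sub _ _).aestronglyMeasurable) (integrable_const _)
    (fun n => ae_of_all _ fun ω => ?_) ?_
  · rw [Real.norm_eq_abs, abs_of_nonneg (le_min zero_le_one (abs_nonneg _))]
    exact min_le_left _ _
  · filter_upwards [h] with ω hω
    have : Tendsto (fun n => min 1 |f n ω - g ω|) atTop (nhds (min 1 |g ω - g ω|)) :=
      tendsto_const_nhds.min (hω.sub_const _).abs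
    simpa using this

theorem measure_one_le_abs_sub_le [IsFiniteMeasure P] (f g : Ω →ₘ[P] ℝ) :
    P {ω | 1 ≤ |f ω - g ω|} ≤ ENNReal.ofReal (dist0 P f g) := by
  have h := mul_meas_ge_le_integral_of_nonneg (μ := P)
    (ae_of_all _ fun ω => le_min zero_le_one (abs_nonneg (f ω - g ω)))
    (integrable_min_one_abs_sub f g) 1
  have hs : {ω | (1 : ℝ) ≤ min 1 |f ω - g ω|} = {ω | 1 ≤ |f ω - g ω|} := by
    ext ω; simp
  rw [hs, one_mul] at h
  rw [← ENNReal.ofReal_toReal (measure_ne_top P _)]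
  exact ENNReal.ofReal_le_ofReal h

/-- Convex subsets of the nonnegative orthant that are bounded in probability and closed under
almost sure convergence of sequences. -/
structure Admissible (P : Measure Ω) (K : Set (Ω →ₘ[P] ℝ)) : Prop where
  nonneg : ∀ f ∈ K, ∀ᵐ ω ∂P, 0 ≤ f ω
  convex : Convex ℝ K
  tight : ∀ ε : ENNReal, 0 < ε → ∃ l : ℝ, ∀ f ∈ K, P {ω | l < f ω} ≤ ε
  closed : ∀ (f : ℕ → Ω →ₘ[P] ℝ) (g : Ω →ₘ[P] ℝ), (∀ n, f n ∈ K) →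
    (∀ᵐ ω ∂P, Tendsto (fun n => f n ω) atTop (nhds (g ω))) → g ∈ K

theorem subset_closure0 (C : Set (Ω →ₘ[P] ℝ)) : C ⊆ closure0 P C := fun f hf ε hε =>
  ⟨f, hf, by rwa [dist0_self]⟩

theorem admissible_closure0 [IsFiniteMeasure P] {C : Set (Ω →ₘ[P] ℝ)} (hC : C ⊆ L0plus P)
    (hconv : Convex ℝ C) (hbdd : Bounded0 P C) : Admissible P (closure0 P C) where
  nonneg := by
    intro f hf
    have hmin_int : Integrable (fun ω => min 1 (max (-f ω) 0)) P := by
      refine integrable_of_measurable_of_le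
        (measurable_const.min (f.measurable.neg.max measurable_const)) 1 fun ω => ?_
      rw [abs_of_nonneg (le_min zero_le_one (le_max_right _ _))]
      exact min_le_left _ _
    have hle : ∫ ω, min 1 (max (-f ω) 0) ∂P ≤ 0 := by
      refine le_of_forall_pos_le_add fun ε hε => ?_
      obtain ⟨g, hg, hfg⟩ := hf ε hε
      rw [zero_add]
      refine le_trans ?_ hfg.le
      refine integral_mono_ae hmin_int (integrable_min_one_abs_sub f g) ?_
      filter_upwards [AEEqFun.coeFn_le.2 (hC hg), AEEqFun.coeFn_zero (α := Ω) (β := ℝ) (μ := P)]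
        with ω h1 h2
      rw [h2] at h1
      refine min_le_min le_rfl (max_le ?_ (abs_nonneg _))
      have h3 : (0 : ℝ) ≤ g ω := h1
      have := neg_abs_le (f ω - g ω)
      linarith
    have h0 := (integral_eq_zero_iff_of_nonneg
      (fun ω => le_min zero_le_one (le_max_right (-f ω) 0)) hmin_int).1
      (le_antisymm hle (integral_nonneg fun ω => le_min zero_le_one (le_max_right (-f ω) 0)))
    filter_upwards [h0] with ω hω
    by_contra! hneg
    have : 0 < min 1 (max (-f ω) 0) := lt_min one_pos (lt_max_of_lt_left (by linarith))
    exact this.ne' hω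
  convex := by
    intro f hf g hg a b ha hb hab ε hε
    obtain ⟨f', hf', h1⟩ := hf (ε / 2) (by positivity)
    obtain ⟨g', hg', h2⟩ := hg (ε / 2) (by positivity)
    refine ⟨a • f' + b • g', hconv hf' hg' ha hb hab, ?_⟩
    have := dist0_combo_le ha hb hab f g f' g'
    linarith
  tight := by
    intro ε hε
    obtain ⟨l, hl⟩ := (hbdd.eventually (gt_mem_nhds (ENNReal.half_pos hε.ne'))).exists
    rcases eq_or_ne ε ⊤ with rfl | htop
    · exact ⟨0, fun _ _ => le_top⟩
    refine ⟨l + 1, fun f hf => ?_⟩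
    have hε2 : 0 < (ε / 2).toReal :=
      ENNReal.toReal_pos (ENNReal.half_pos hε.ne').ne' (ENNReal.div_ne_top htop (by simp))
    obtain ⟨g, hg, hfg⟩ := hf _ hε2
    have hsub : {ω | l + 1 < f ω} ⊆ {ω | l < g ω} ∪ {ω | 1 ≤ |f ω - g ω|} := by
      intro ω hω
      by_contra! hcon
      simp only [mem_union, mem_ofPred_eq, not_or, not_lt, not_le] at hcon hω
      have := (le_abs_self _).trans_lt hcon.2
      linarith [hcon.1]
    calc P {ω | l + 1 < f ω} ≤ P {ω | l < g ω} + P {ω | 1 ≤ |f ω - g ω|} :=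
          (measure_mono hsub).trans (measure_union_le _ _)
      _ ≤ ε / 2 + ε / 2 := by
          refine add_le_add ?_ ?_
          · exact (le_iSup₂ (f := fun (f : Ω →ₘ[P] ℝ) (_ : f ∈ C) => P {ω | l < f ω}) g hg).trans
              hl.le
          · refine (measure_one_le_abs_sub_le f g).trans ?_
            rw [← ENNReal.ofReal_toReal (a := ε / 2) (ENNReal.div_ne_top htop (by simp))]
            exact ENNReal.ofReal_le_ofReal hfg.le
      _ = ε := ENNReal.add_halves ε
  closed := by
    intro f g hf hfg ε hε
    obtain ⟨n, hn⟩ :=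
      ((tendsto_dist0_of_ae_tendsto hfg).eventually (gt_mem_nhds (half_pos hε))).exists
    obtain ⟨h, hh, hd⟩ := hf n (ε / 2) (half_pos hε)
    refine ⟨h, hh, ?_⟩
    have h1 := dist0_triangle g (f n) h
    have h2 : dist0 P g (f n) = dist0 P (f n) g := by
      simp only [dist0, abs_sub_comm]
    linarith

theorem Admissible.inter_Ici {K : Set (Ω →ₘ[P] ℝ)} (hK : Admissible P K) (g : Ω →ₘ[P] ℝ) :
    Admissible P (K ∩ Ici g) where
  nonneg f hf := hK.nonneg f hf.1
  convex := by
    intro f hf f' hf' a b ha hb hab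
    refine ⟨hK.convex hf.1 hf'.1 ha hb hab, ?_⟩
    refine AEEqFun.coeFn_le.1 ?_
    filter_upwards [AEEqFun.coeFn_le.2 hf.2, AEEqFun.coeFn_le.2 hf'.2, coeFn_combo a b f f']
      with ω h1 h2 h3
    rw [h3]
    calc g ω = a * g ω + b * g ω := by rw [← add_mul, hab, one_mul]
      _ ≤ _ := by gcongr
  tight ε hε := (hK.tight ε hε).imp fun _ h f hf => h f hf.1
  closed := by
    intro f h hf hfh
    refine ⟨hK.closed f h (fun n => (hf n).1) hfh, ?_⟩
    refine AEEqFun.coeFn_le.1 ?_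
    filter_upwards [hfh, ae_all_iff.2 fun n => AEEqFun.coeFn_le.2 (hf n).2] with ω h1 h2
    exact ge_of_tendsto' h1 h2

end MetricLemmas

section Kernels

/-- A strictly decreasing and strictly convex function on the half-line, with values in
`(0, 1]`. -/
noncomputable def invKernel (x : ℝ) : ℝ := (1 + |x|)⁻¹

/-- The normalized square of the amount by which `|x|` falls short of `a`. -/
noncomputable def shortfall (a x : ℝ) : ℝ := (max (a - |x|) 0 / (1 + |a|)) ^ 2

theorem one_add_abs_pos (x : ℝ) : 0 < 1 + |x| := by positivity

theorem invKernel_pos (x : ℝ) : 0 < invKernel x := inv_pos.2 (one_add_abs_pos x)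

theorem invKernel_le_one (x : ℝ) : invKernel x ≤ 1 :=
  inv_le_one_of_one_le₀ (by linarith [abs_nonneg x])

theorem abs_invKernel_le_one (x : ℝ) : |invKernel x| ≤ 1 := by
  rw [abs_of_pos (invKernel_pos x)]; exact invKernel_le_one x

theorem continuous_invKernel : Continuous invKernel :=
  (continuous_const.add continuous_abs).inv₀ fun x => (one_add_abs_pos x).ne'

theorem shortfall_nonneg (a x : ℝ) : 0 ≤ shortfall a x := sq_nonneg _

theorem shortfall_le_one (a x : ℝ) : shortfall a x ≤ 1 := by
  refine pow_le_one₀ (div_nonneg (le_max_right _ _) (one_add_abs_pos a).le) ?_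
  rw [div_le_one (one_add_abs_pos a)]
  exact max_le (by linarith [le_abs_self a, abs_nonneg x]) (one_add_abs_pos a).le

theorem abs_shortfall_le_one (a x : ℝ) : |shortfall a x| ≤ 1 := by
  rw [abs_of_nonneg (shortfall_nonneg a x)]; exact shortfall_le_one a x

theorem continuous_shortfall : Continuous fun p : ℝ × ℝ => shortfall p.1 p.2 := by
  unfold shortfall
  refine Continuous.pow (Continuous.div ?_ ?_ fun p : ℝ × ℝ => (one_add_abs_pos p.1).ne') 2 <;> fun_prop

theorem continuous_shortfall_right (a : ℝ) : Continuous (shortfall a) :=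
  continuous_shortfall.comp (continuous_const.prodMk continuous_id)

theorem invKernel_midpoint_le {x y : ℝ} (hx : 0 ≤ x) (hy : 0 ≤ y) :
    invKernel (1 / 2 * x + 1 / 2 * y) + 1 / 4 * (invKernel x - invKernel y) ^ 2 ≤
      1 / 2 * invKernel x + 1 / 2 * invKernel y := by
  unfold invKernel
  rw [abs_of_nonneg hx, abs_of_nonneg hy, abs_of_nonneg (by positivity)]
  have key : 1 / 2 * (1 + x)⁻¹ + 1 / 2 * (1 + y)⁻¹ -
      ((1 + (1 / 2 * x + 1 / 2 * y))⁻¹ + 1 / 4 * ((1 + x)⁻¹ - (1 + y)⁻¹) ^ 2) =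
      (x - y) ^ 2 * (x + y + 2 * x * y) / (4 * (1 + x) ^ 2 * (1 + y) ^ 2 * (2 + x + y)) := by
    have h1 : 1 + x ≠ 0 := by positivity
    have h2 : 1 + y ≠ 0 := by positivity
    have h3 : 2 + x + y ≠ 0 := by positivity
    have h4 : 1 + (1 / 2 * x + 1 / 2 * y) = (2 + x + y) / 2 := by ring
    rw [h4]
    field_simp
    ring
  have : 0 ≤ (x - y) ^ 2 * (x + y + 2 * x * y) /
      (4 * (1 + x) ^ 2 * (1 + y) ^ 2 * (2 + x + y)) := by positivity
  linarith

theorem invKernel_antitone {x y : ℝ} (hx : 0 ≤ x) (hxy : x ≤ y) : invKernel y ≤ invKernel x := by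
  unfold invKernel
  rw [abs_of_nonneg hx, abs_of_nonneg (hx.trans hxy)]
  gcongr

theorem eq_of_invKernel_eq {x y : ℝ} (hx : 0 ≤ x) (hy : 0 ≤ y) (h : invKernel x = invKernel y) :
    x = y := by
  unfold invKernel at h
  rw [abs_of_nonneg hx, abs_of_nonneg hy, inv_inj] at h
  linarith

theorem shortfall_antitone (a : ℝ) {x y : ℝ} (hx : 0 ≤ x) (hxy : x ≤ y) :
    shortfall a y ≤ shortfall a x := by
  unfold shortfall
  rw [abs_of_nonneg hx, abs_of_nonneg (hx.trans hxy)]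
  have := one_add_abs_pos a
  gcongr

theorem convexOn_shortfall (a : ℝ) : ConvexOn ℝ (Ici 0) (shortfall a) := by
  have h1 : ConvexOn ℝ (Ici 0) fun x : ℝ => (max (a - x) 0 / (1 + |a|)) := by
    have h : ConvexOn ℝ (Ici (0 : ℝ)) fun x : ℝ => a - x :=
      (convexOn_const a (convex_Ici 0)).sub (concaveOn_id (convex_Ici 0))
    have := (h.sup (convexOn_const 0 (convex_Ici 0))).smul (inv_nonneg.2 (one_add_abs_pos a).le)
    refine this.congr fun x _ => ?_
    simp [div_eq_inv_mul]
  have h2 := h1.pow (fun x _ => div_nonneg (le_max_right _ _) (one_add_abs_pos a).le) 2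
  refine h2.congr fun x hx => ?_
  simp [shortfall, abs_of_nonneg (show (0 : ℝ) ≤ x from hx)]

theorem convexOn_invKernel : ConvexOn ℝ (Ici 0) invKernel := by
  have h := (convexOn_zpow (𝕜 := ℝ) (-1)).translate_right 1
  refine (h.subset (fun x hx => ?_) (convex_Ici 0)).congr fun x hx => ?_
  · have : (0 : ℝ) ≤ x := hx
    simp only [mem_preimage, mem_Ioi]
    linarith
  · simp [invKernel, abs_of_nonneg (show (0 : ℝ) ≤ x from hx)]

end Kernels

section Minimization

variable {Ω : Type*} [MeasurableSpace Ω] {P : Measure Ω}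

/-- The expected inverse kernel. -/
noncomputable def meanInv (P : Measure Ω) (f : Ω →ₘ[P] ℝ) : ℝ := ∫ ω, invKernel (f ω) ∂P

/-- The expected shortfall of `f` with respect to `g`. -/
noncomputable def meanShortfall (P : Measure Ω) (g f : Ω →ₘ[P] ℝ) : ℝ := ∫ ω, shortfall (g ω) (f ω) ∂P

theorem measurable_invKernel_comp (f : Ω →ₘ[P] ℝ) : Measurable fun ω => invKernel (f ω) :=
  continuous_invKernel.measurable.comp f.measurable

theorem measurable_shortfall_comp (g f : Ω →ₘ[P] ℝ) :
    Measurable fun ω => shortfall (g ω) (f ω) :=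
  continuous_shortfall.measurable.comp (g.measurable.prodMk f.measurable)

theorem integrable_invKernel [IsFiniteMeasure P] (f : Ω →ₘ[P] ℝ) :
    Integrable (fun ω => invKernel (f ω)) P :=
  integrable_of_measurable_of_le (measurable_invKernel_comp f) 1 fun _ => abs_invKernel_le_one _

theorem integrable_shortfall [IsFiniteMeasure P] (g f : Ω →ₘ[P] ℝ) :
    Integrable (fun ω => shortfall (g ω) (f ω)) P :=
  integrable_of_measurable_of_le (measurable_shortfall_comp g f) 1 fun _ => abs_shortfall_le_one _ _

theorem abs_invKernel_sub_le_one (x y : ℝ) : |invKernel x - invKernel y| ≤ 1 := by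
  rw [abs_le]
  constructor <;>
    linarith [invKernel_pos x, invKernel_le_one x, invKernel_pos y, invKernel_le_one y]

theorem integrable_sq_invKernel_sub [IsFiniteMeasure P] (f g : Ω →ₘ[P] ℝ) :
    Integrable (fun ω => (invKernel (f ω) - invKernel (g ω)) ^ 2) P :=
  integrable_of_measurable_of_le
    (((measurable_invKernel_comp f).sub (measurable_invKernel_comp g)).pow_const 2) 1 fun ω => by
      rw [abs_pow]
      exact pow_le_one₀ (abs_nonneg _) (abs_invKernel_sub_le_one _ _)

theorem tendsto_meanInv [IsFiniteMeasure P] {f : ℕ → Ω →ₘ[P] ℝ} {h : Ω →ₘ[P] ℝ}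
    (hf : ∀ᵐ ω ∂P, Tendsto (fun n => f n ω) atTop (nhds (h ω))) :
    Tendsto (fun n => meanInv P (f n)) atTop (nhds (meanInv P h)) := by
  unfold meanInv
  refine tendsto_integral_of_dominated_convergence (fun _ => 1)
    (fun n => (measurable_invKernel_comp _).aestronglyMeasurable) (integrable_const _)
    (fun n => ae_of_all _ fun ω => abs_invKernel_le_one _) ?_
  filter_upwards [hf] with ω hω
  exact (continuous_invKernel.tendsto _).comp hω

theorem tendsto_meanShortfall [IsFiniteMeasure P] (g : Ω →ₘ[P] ℝ) {f : ℕ → Ω →ₘ[P] ℝ}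
    {h : Ω →ₘ[P] ℝ} (hf : ∀ᵐ ω ∂P, Tendsto (fun n => f n ω) atTop (nhds (h ω))) :
    Tendsto (fun n => meanShortfall P g (f n)) atTop (nhds (meanShortfall P g h)) := by
  have hlim : ∀ᵐ ω ∂P, Tendsto (fun n => shortfall (g ω) (f n ω)) atTop
      (nhds (shortfall (g ω) (h ω))) := by
    filter_upwards [hf] with ω hω
    exact (continuous_shortfall_right (g ω)).continuousAt.tendsto.comp hω
  exact tendsto_integral_of_dominated_convergence (fun _ => 1)
    (fun n => (measurable_shortfall_comp g (f n)).aestronglyMeasurable) (integrable_const _)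
    (fun n => ae_of_all _ fun ω => abs_shortfall_le_one (g ω) (f n ω)) hlim

theorem meanInv_nonneg (f : Ω →ₘ[P] ℝ) : 0 ≤ meanInv P f :=
  integral_nonneg fun _ => (invKernel_pos _).le

theorem meanInv_le_one [IsProbabilityMeasure P] (f : Ω →ₘ[P] ℝ) : meanInv P f ≤ 1 := by
  have := integral_mono (integrable_invKernel f) (integrable_const (1 : ℝ))
    fun ω => invKernel_le_one (f ω)
  simpa [meanInv] using this

theorem meanShortfall_nonneg (g f : Ω →ₘ[P] ℝ) : 0 ≤ meanShortfall P g f :=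
  integral_nonneg fun _ => shortfall_nonneg _ _

theorem meanInv_midpoint_le [IsFiniteMeasure P] {f f' : Ω →ₘ[P] ℝ} (hf : ∀ᵐ ω ∂P, 0 ≤ f ω)
    (hf' : ∀ᵐ ω ∂P, 0 ≤ f' ω) :
    meanInv P ((1 / 2 : ℝ) • f + (1 / 2 : ℝ) • f') +
      1 / 4 * ∫ ω, (invKernel (f ω) - invKernel (f' ω)) ^ 2 ∂P ≤
        1 / 2 * meanInv P f + 1 / 2 * meanInv P f' := by
  unfold meanInv
  rw [← integral_const_mul, ← integral_const_mul, ← integral_const_mul,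
    ← integral_add (integrable_invKernel _) ((integrable_sq_invKernel_sub _ _).const_mul _),
    ← integral_add ((integrable_invKernel _).const_mul _) ((integrable_invKernel _).const_mul _)]
  refine integral_mono_ae
    ((integrable_invKernel _).add ((integrable_sq_invKernel_sub _ _).const_mul _))
    (((integrable_invKernel _).const_mul _).add ((integrable_invKernel _).const_mul _)) ?_
  filter_upwards [hf, hf', coeFn_combo (1 / 2) (1 / 2) f f'] with ω h1 h2 h3
  simp only [h3]
  exact invKernel_midpoint_le h1 h2

theorem meanShortfall_midpoint_le [IsFiniteMeasure P] (g : Ω →ₘ[P] ℝ) {f f' : Ω →ₘ[P] ℝ}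
    (hf : ∀ᵐ ω ∂P, 0 ≤ f ω) (hf' : ∀ᵐ ω ∂P, 0 ≤ f' ω) :
    meanShortfall P g ((1 / 2 : ℝ) • f + (1 / 2 : ℝ) • f') ≤
      1 / 2 * meanShortfall P g f + 1 / 2 * meanShortfall P g f' := by
  unfold meanShortfall
  rw [← integral_const_mul, ← integral_const_mul,
    ← integral_add ((integrable_shortfall _ _).const_mul _) ((integrable_shortfall _ _).const_mul _)]
  refine integral_mono_ae (integrable_shortfall _ _)
    (((integrable_shortfall _ _).const_mul _).add ((integrable_shortfall _ _).const_mul _)) ?_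
  filter_upwards [hf, hf', coeFn_combo (1 / 2) (1 / 2) f f'] with ω h1 h2 h3
  simp only [h3]
  exact (convexOn_shortfall (g ω)).2 h1 h2 (by norm_num) (by norm_num) (by norm_num)

theorem eLpNorm_two_lt_of_integral_sq_le {F : Ω → ℝ} (hF : MemLp F 2 P) {c : ℝ} (hc : 0 < c)
    (h : ∫ ω, F ω ^ 2 ∂P ≤ c ^ 2) : eLpNorm F 2 P < ENNReal.ofReal (2 * c) := by
  rw [hF.eLpNorm_eq_integral_rpow_norm (by simp) (by simp),
    ENNReal.ofReal_lt_ofReal_iff (by positivity)]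
  have h1 : ∫ ω, ‖F ω‖ ^ (2 : ENNReal).toReal ∂P = ∫ ω, F ω ^ 2 ∂P := by simp
  rw [h1]
  calc (∫ ω, F ω ^ 2 ∂P) ^ (2 : ENNReal).toReal⁻¹ ≤ (c ^ 2) ^ (2 : ENNReal).toReal⁻¹ := by
        have : 0 ≤ ∫ ω, F ω ^ 2 ∂P := integral_nonneg fun _ => sq_nonneg _
        gcongr
    _ = c := by
        have := Real.pow_rpow_inv_natCast hc.le (n := 2) (by norm_num)
        simpa using this
    _ < 2 * c := by linarith

theorem Admissible.exists_ae_tendsto [IsFiniteMeasure P] {K : Set (Ω →ₘ[P] ℝ)}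
    (hK : Admissible P K) {f : ℕ → Ω →ₘ[P] ℝ} (hf : ∀ n, f n ∈ K)
    (hcau : ∀ N n m, N ≤ n → N ≤ m →
      ∫ ω, (invKernel (f n ω) - invKernel (f m ω)) ^ 2 ∂P ≤ ((1 / 4 : ℝ) ^ N) ^ 2) :
    ∃ h ∈ K, ∀ᵐ ω ∂P, Tendsto (fun n => f n ω) atTop (nhds (h ω)) := by
  have hlim : ∀ᵐ ω ∂P, ∃ l : ℝ, Tendsto (fun n => invKernel (f n ω)) atTop (nhds l) := by
    refine Lp.ae_tendsto_of_cauchy_eLpNorm (p := 2)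
      (B := fun N => ENNReal.ofReal (2 * (1 / 4 : ℝ) ^ N))
      (fun n => (measurable_invKernel_comp (f n)).aestronglyMeasurable) (by norm_num) ?_ ?_
    · exact ((summable_geometric_of_lt_one (by norm_num) (by norm_num)).mul_left
        2).tsum_ofReal_ne_top
    · intro N n m hn hm
      refine eLpNorm_two_lt_of_integral_sq_le ?_ (by positivity) (hcau N n m hn hm)
      exact MemLp.of_bound ((measurable_invKernel_comp (f n)).sub
        (measurable_invKernel_comp (f m))).aestronglyMeasurable 1
        (ae_of_all _ fun ω => abs_invKernel_sub_le_one _ _)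
  obtain ⟨L, hLm, hL⟩ := measurable_limit_of_tendsto_metrizable_ae
    (fun n => (measurable_invKernel_comp (f n)).aemeasurable) hlim
  have hnonneg : ∀ᵐ ω ∂P, ∀ n, 0 ≤ f n ω := ae_all_iff.2 fun n => hK.nonneg _ (hf n)
  have hpos : ∀ᵐ ω ∂P, L ω ≠ 0 := by
    rw [ae_iff]
    refine le_antisymm (le_of_forall_gt_imp_ge_of_dense fun ε hε => ?_) bot_le
    obtain ⟨l, hl⟩ := hK.tight ε hε
    have hmono : Monotone fun N : ℕ => ⋂ n ≥ N, {ω | l < f n ω} := fun N M hNM =>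
      biInter_subset_biInter_left fun n hn => hNM.trans hn
    calc P {ω | ¬L ω ≠ 0} ≤ P (⋃ N : ℕ, ⋂ n ≥ N, {ω | l < f n ω}) := by
          refine measure_mono_ae ?_
          filter_upwards [hL, hnonneg] with ω h1 h2 h3
          have h3' : L ω = 0 := not_not.1 h3
          rw [h3'] at h1
          obtain ⟨N, hN⟩ := eventually_atTop.1
            (h1.eventually (gt_mem_nhds (invKernel_pos l)))
          refine mem_iUnion.2 ⟨N, mem_iInter₂.2 fun n hn => ?_⟩
          have h4 := hN n hn
          unfold invKernel at h4
          rw [inv_lt_inv₀ (one_add_abs_pos _) (one_add_abs_pos _), abs_of_nonneg (h2 n)] at h4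
          exact (le_abs_self l).trans_lt (by linarith)
      _ = ⨆ N : ℕ, P (⋂ n ≥ N, {ω | l < f n ω}) := hmono.measure_iUnion
      _ ≤ ε := iSup_le fun N =>
          (measure_mono (biInter_subset_of_mem (mem_Ici.2 le_rfl))).trans (hl _ (hf N))
  have hmeas : Measurable fun ω => (L ω)⁻¹ - 1 := hLm.inv.sub_const 1
  let h : Ω →ₘ[P] ℝ := AEEqFun.mk _ hmeas.aestronglyMeasurable
  have key : ∀ᵐ ω ∂P, Tendsto (fun n => f n ω) atTop (nhds (h ω)) := by
    filter_upwards [hL, hpos, hnonneg, AEEqFun.coeFn_mk _ hmeas.aestronglyMeasurable]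
      with ω h1 h2 h3 h4
    rw [show h ω = (L ω)⁻¹ - 1 from h4]
    refine ((h1.inv₀ h2).sub_const 1).congr fun n => ?_
    simp [invKernel, abs_of_nonneg (h3 n)]
  exact ⟨_, hK.closed f _ hf key, key⟩

theorem Admissible.exists_minimizer [IsFiniteMeasure P] {K : Set (Ω →ₘ[P] ℝ)}
    (hK : Admissible P K) (hne : K.Nonempty) {ε : ℝ} (hε : 0 < ε) (g : Ω →ₘ[P] ℝ) :
    ∃ h ∈ K, ∀ f ∈ K,
      ε * meanInv P h + meanShortfall P g h ≤ ε * meanInv P f + meanShortfall P g f := by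
  set G : (Ω →ₘ[P] ℝ) → ℝ := fun f => ε * meanInv P f + meanShortfall P g f with hG
  have hG0 : ∀ f, 0 ≤ G f := fun f =>
    add_nonneg (mul_nonneg hε.le (meanInv_nonneg f)) (meanShortfall_nonneg g f)
  have hbdd : BddBelow (G '' K) := ⟨0, by rintro _ ⟨f, -, rfl⟩; exact hG0 f⟩
  have hinf : ∀ f ∈ K, sInf (G '' K) ≤ G f := fun f hf => csInf_le hbdd ⟨f, hf, rfl⟩
  have hex : ∀ n : ℕ, ∃ f ∈ K, G f < sInf (G '' K) + ε / 4 * ((1 / 4 : ℝ) ^ n) ^ 2 := by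
    intro n
    obtain ⟨_, ⟨f, hf, rfl⟩, h⟩ := exists_lt_of_csInf_lt (hne.image G)
      (lt_add_of_pos_right (sInf (G '' K))
        (show (0 : ℝ) < ε / 4 * ((1 / 4 : ℝ) ^ n) ^ 2 by positivity))
    exact ⟨f, hf, h⟩
  choose f hfK hfG using hex
  have hanti : ∀ N n : ℕ, N ≤ n → ((1 / 4 : ℝ) ^ n) ^ 2 ≤ ((1 / 4 : ℝ) ^ N) ^ 2 := fun N n h =>
    pow_le_pow_left₀ (by positivity) (pow_le_pow_of_le_one (by norm_num) (by norm_num) h) 2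
  obtain ⟨h, hhK, hlim⟩ := hK.exists_ae_tendsto hfK fun N n m hn hm => by
    have h1 := meanInv_midpoint_le (hK.nonneg _ (hfK n)) (hK.nonneg _ (hfK m))
    have h2 := meanShortfall_midpoint_le g (hK.nonneg _ (hfK n)) (hK.nonneg _ (hfK m))
    have h3 := hinf _ (hK.convex (hfK n) (hfK m) (by norm_num : (0 : ℝ) ≤ 1 / 2)
      (by norm_num : (0 : ℝ) ≤ 1 / 2) (by norm_num))
    have h4 := hfG n
    have h5 := hfG m
    have h6 := mul_le_mul_of_nonneg_left (hanti N n hn) hε.le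
    have h7 := mul_le_mul_of_nonneg_left (hanti N m hm) hε.le
    have h8 := mul_le_mul_of_nonneg_left h1 hε.le
    simp only [hG] at h3 h4 h5
    refine le_of_mul_le_mul_left ?_ hε
    linarith
  refine ⟨h, hhK, fun f' hf' => le_trans ?_ (hinf f' hf')⟩
  have hGlim : Tendsto (fun n => G (f n)) atTop (nhds (G h)) :=
    ((tendsto_meanInv hlim).const_mul ε).add (tendsto_meanShortfall g hlim)
  have hzero : Tendsto (fun n : ℕ => sInf (G '' K) + ε / 4 * ((1 / 4 : ℝ) ^ n) ^ 2) atTop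
      (nhds (sInf (G '' K) + ε / 4 * (0 : ℝ) ^ 2)) :=
    (((tendsto_pow_atTop_nhds_zero_of_lt_one (by norm_num) (by norm_num)).pow 2).const_mul
      _).const_add _
  have := le_of_tendsto_of_tendsto' hGlim hzero fun n => (hfG n).le
  simpa using this

theorem Admissible.mem_maxSet_of_minimizer [IsFiniteMeasure P] {K : Set (Ω →ₘ[P] ℝ)}
    (hK : Admissible P K) {ε : ℝ} (hε : 0 < ε) {g h : Ω →ₘ[P] ℝ} (hh : h ∈ K)
    (hmin : ∀ f ∈ K,
      ε * meanInv P h + meanShortfall P g h ≤ ε * meanInv P f + meanShortfall P g f) :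
    h ∈ maxSet P K := by
  refine ⟨hh, fun f hf hhf => ?_⟩
  have hle := AEEqFun.coeFn_le.2 hhf
  have h0 := hK.nonneg h hh
  have hA : meanShortfall P g f ≤ meanShortfall P g h := by
    refine integral_mono_ae (integrable_shortfall _ _) (integrable_shortfall _ _) ?_
    filter_upwards [hle, h0] with ω h1 h2
    exact shortfall_antitone _ h2 h1
  have hJle : (fun ω => invKernel (f ω)) ≤ᵐ[P] fun ω => invKernel (h ω) := by
    filter_upwards [hle, h0] with ω h1 h2
    exact invKernel_antitone h2 h1
  have hJ : meanInv P f = meanInv P h := by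
    refine le_antisymm (integral_mono_ae (integrable_invKernel _) (integrable_invKernel _) hJle) ?_
    have := hmin f hf
    exact le_of_mul_le_mul_left (by linarith) hε
  have heq := (integral_eq_iff_of_ae_le (integrable_invKernel f) (integrable_invKernel h) hJle).1 hJ
  refine AEEqFun.ext ?_
  filter_upwards [heq, h0, hK.nonneg f hf] with ω h1 h2 h3
  exact (eq_of_invKernel_eq h3 h2 h1).symm

theorem Admissible.exists_le_mem_maxSet [IsFiniteMeasure P] {K : Set (Ω →ₘ[P] ℝ)}
    (hK : Admissible P K) {f : Ω →ₘ[P] ℝ} (hf : f ∈ K) : ∃ h ∈ maxSet P K, f ≤ h := by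
  obtain ⟨h, hh, hmin⟩ := (hK.inter_Ici f).exists_minimizer ⟨f, hf, self_mem_Ici⟩ one_pos 0
  have hmax := (hK.inter_Ici f).mem_maxSet_of_minimizer one_pos hh hmin
  exact ⟨h, ⟨hh.1, fun f' hf' hle => hmax.2 f' ⟨hf', hh.2.trans hle⟩ hle⟩, hh.2⟩

end Minimization

section FirstOrder

variable {Ω : Type*} [MeasurableSpace Ω] {P : Measure Ω}

/-- Minus the slope at `x` of the penalty `ε * invKernel + shortfall a`. -/
noncomputable def slope0 (ε a x : ℝ) : ℝ :=
  ε * invKernel x ^ 2 + 2 * max (a - |x|) 0 / (1 + |a|) ^ 2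

theorem slope0_pos {ε : ℝ} (hε : 0 < ε) (a x : ℝ) : 0 < slope0 ε a x := by
  have h1 := invKernel_pos x
  have h2 := one_add_abs_pos a
  have h3 : 0 ≤ max (a - |x|) 0 := le_max_right _ _
  unfold slope0
  positivity

theorem measurable_slope0_comp (ε : ℝ) (g f : Ω →ₘ[P] ℝ) :
    Measurable fun ω => slope0 ε (g ω) (f ω) := by
  have h1 := g.measurable
  have h2 := f.measurable
  have h3 := measurable_invKernel_comp f
  unfold slope0
  fun_prop

theorem slope0_mul_self_le {ε : ℝ} (hε : 0 < ε) (a : ℝ) {x : ℝ} (hx : 0 ≤ x) :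
    slope0 ε a x * x ≤ ε + 2 := by
  have h1 : invKernel x * x ≤ 1 := by
    unfold invKernel
    rw [abs_of_nonneg hx, inv_mul_le_one₀ (by positivity)]
    linarith
  have h2 : invKernel x ^ 2 * x ≤ 1 := by
    have := mul_le_one₀ (invKernel_le_one x) (mul_nonneg (invKernel_pos x).le hx) h1
    calc _ = invKernel x * (invKernel x * x) := by ring
      _ ≤ 1 := this
  have h3 : max (a - |x|) 0 * x / (1 + |a|) ^ 2 ≤ 1 := by
    rw [div_le_one (pow_pos (one_add_abs_pos a) 2), abs_of_nonneg hx]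
    rcases le_total (a - x) 0 with h | h
    · rw [max_eq_right h]
      simp only [zero_mul]
      positivity
    · rw [max_eq_left h]
      have := le_abs_self a
      nlinarith
  unfold slope0
  calc _ = ε * (invKernel x ^ 2 * x) + 2 * (max (a - |x|) 0 * x / (1 + |a|) ^ 2) := by ring
    _ ≤ ε * 1 + 2 * 1 := by gcongr
    _ = _ := by ring

theorem invKernel_sub_eq {x d t : ℝ} (hx : 0 ≤ x) (hy : 0 ≤ x + t * d) :
    invKernel x - invKernel (x + t * d) = t * (d * invKernel x * invKernel (x + t * d)) := by
  unfold invKernel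
  rw [abs_of_nonneg hx, abs_of_nonneg hy]
  have h1 : 1 + x ≠ 0 := by positivity
  have h2 : 1 + (x + t * d) ≠ 0 := by positivity
  field_simp
  ring

theorem le_shortfall_sub (a : ℝ) {x d t : ℝ} (hx : 0 ≤ x) (hy : 0 ≤ x + t * d) :
    t * ((2 * max (a - |x|) 0 * d - t * d ^ 2) / (1 + |a|) ^ 2) ≤
      shortfall a x - shortfall a (x + t * d) := by
  unfold shortfall
  rw [abs_of_nonneg hx, abs_of_nonneg hy, div_pow, div_pow, ← sub_div, ← mul_div_assoc]
  have h2 := one_add_abs_pos a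
  gcongr
  have h : max (a - (x + t * d)) 0 ^ 2 ≤ (max (a - x) 0 - t * d) ^ 2 := by
    rw [← sq_abs (max (a - x) 0 - t * d)]
    refine pow_le_pow_left₀ (le_max_right _ _) (max_le ?_ (abs_nonneg _)) 2
    exact le_trans (by linarith [le_max_left (a - x) 0]) (le_abs_self _)
  linarith

theorem Admissible.lintegral_slope_mul_le [IsProbabilityMeasure P] {K : Set (Ω →ₘ[P] ℝ)}
    (hK : Admissible P K) {ε : ℝ} (hε : 0 < ε) {g h : Ω →ₘ[P] ℝ} (hh : h ∈ K)
    (hmin : ∀ f ∈ K,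
      ε * meanInv P h + meanShortfall P g h ≤ ε * meanInv P f + meanShortfall P g f)
    {f : Ω →ₘ[P] ℝ} (hf : f ∈ K) :
    ∫⁻ ω, ENNReal.ofReal (slope0 ε (g ω) (h ω) * f ω) ∂P ≤
      ∫⁻ ω, ENNReal.ofReal (slope0 ε (g ω) (h ω) * h ω) ∂P := by
  set c : ℝ := ε + 1 with hc
  have hc0 : 0 < c := by positivity
  set t : ℕ → ℝ := fun n => 1 / ((n : ℝ) + 1) with ht
  have ht0 : ∀ n, 0 < t n := fun n => Nat.one_div_pos_of_nat
  have ht1 : ∀ n, t n ≤ 1 := fun n => by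
    simp only [ht]
    rw [div_le_one (by positivity)]
    linarith [n.cast_nonneg (α := ℝ)]
  have htlim : Tendsto t atTop (nhds 0) := tendsto_one_div_add_atTop_nhds_zero_nat
  set y : ℕ → Ω →ₘ[P] ℝ := fun n => (1 - t n) • h + t n • f with hy
  have hyK : ∀ n, y n ∈ K := fun n =>
    hK.convex hh hf (sub_nonneg.2 (ht1 n)) (ht0 n).le (by ring)
  have hyval : ∀ᵐ ω ∂P, ∀ n, y n ω = (1 - t n) * h ω + t n * f ω :=
    ae_all_iff.2 fun n => coeFn_combo _ _ _ _
  have hynn : ∀ᵐ ω ∂P, ∀ n, 0 ≤ y n ω := ae_all_iff.2 fun n => hK.nonneg _ (hyK n)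
  let k : (Ω →ₘ[P] ℝ) → Ω → ℝ := fun f ω => ε * invKernel (f ω) + shortfall (g ω) (f ω)
  have hkint : ∀ f, Integrable (k f) P := fun f =>
    ((integrable_invKernel f).const_mul ε).add (integrable_shortfall g f)
  have hkval : ∀ f, ∫ ω, k f ω ∂P = ε * meanInv P f + meanShortfall P g f := fun f => by
    simp only [k]
    rw [integral_add ((integrable_invKernel f).const_mul ε) (integrable_shortfall g f),
      integral_const_mul]
    rfl
  let D : ℕ → Ω → ℝ := fun n ω => (t n)⁻¹ * (k h ω - k (y n) ω) + c
  have hDint : ∀ n, Integrable (D n) P := fun n =>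
    (((hkint h).sub (hkint (y n))).const_mul _).add (integrable_const c)
  have hDle : ∀ n, ∫ ω, D n ω ∂P ≤ c := fun n => by
    have hkd : Integrable (fun ω => (t n)⁻¹ * (k h ω - k (y n) ω)) P :=
      ((hkint h).sub (hkint (y n))).const_mul _
    simp only [D]
    rw [integral_add hkd (integrable_const c),
      integral_const_mul, integral_sub (hkint h) (hkint (y n)), hkval, hkval]
    have h1 := mul_nonneg (inv_pos.2 (ht0 n)).le (sub_nonneg.2 (hmin _ (hyK n)))
    simp only [integral_const, probReal_univ, one_smul]
    linarith
  have hDnn : ∀ n, 0 ≤ᵐ[P] D n := fun n => by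
    filter_upwards [hyval, hK.nonneg h hh, hK.nonneg f hf] with ω h1 h2 h3
    have hconv1 := convexOn_invKernel.2 h2 h3 (sub_nonneg.2 (ht1 n)) (ht0 n).le (by ring)
    have hconv2 := (convexOn_shortfall (g ω)).2 h2 h3 (sub_nonneg.2 (ht1 n)) (ht0 n).le (by ring)
    simp only [smul_eq_mul, ← h1 n] at hconv1 hconv2
    have hlow : -(t n * c) ≤ k h ω - k (y n) ω := by
      have e1 := mul_le_mul_of_nonneg_left hconv1 hε.le
      have e2 : ε * invKernel (f ω) + shortfall (g ω) (f ω) ≤ c := by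
        have := mul_le_mul_of_nonneg_left (invKernel_le_one (f ω)) hε.le
        have := shortfall_le_one (g ω) (f ω)
        linarith
      have e3 := mul_le_mul_of_nonneg_left e2 (ht0 n).le
      have e4 := mul_nonneg (ht0 n).le (add_nonneg (mul_nonneg hε.le (invKernel_pos (h ω)).le)
        (shortfall_nonneg (g ω) (h ω)))
      simp only [k]
      linarith
    have := mul_le_mul_of_nonneg_left hlow (inv_pos.2 (ht0 n)).le
    have e5 : (t n)⁻¹ * -(t n * c) = -c := by
      have := (ht0 n).ne'
      field_simp
    simp only [D, Pi.zero_apply]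
    linarith
  have hliminf : ∀ᵐ ω ∂P, ENNReal.ofReal (slope0 ε (g ω) (h ω) * (f ω - h ω) + c) ≤
      liminf (fun n => ENNReal.ofReal (D n ω)) atTop := by
    filter_upwards [hyval, hynn, hK.nonneg h hh] with ω h1 h2 h3
    set d := f ω - h ω with hd
    have h4 : ∀ n, y n ω = h ω + t n * d := fun n => by rw [h1 n, hd]; ring
    let E : ℕ → ℝ := fun n => ε * (d * invKernel (h ω) * invKernel (h ω + t n * d)) +
      (2 * max (g ω - |h ω|) 0 * d - t n * d ^ 2) / (1 + |g ω|) ^ 2 + c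
    have hE : Tendsto E atTop (nhds (slope0 ε (g ω) (h ω) * d + c)) := by
      have e1 : Tendsto (fun n => h ω + t n * d) atTop (nhds (h ω + 0 * d)) :=
        (htlim.mul_const d).const_add _
      have e2 := (continuous_invKernel.tendsto _).comp e1
      have e3 := (((e2.const_mul (d * invKernel (h ω))).const_mul ε).add
        (((htlim.mul_const (d ^ 2)).const_sub (2 * max (g ω - |h ω|) 0 * d)).div_const
          ((1 + |g ω|) ^ 2))).add_const c
      have e4 : ε * (d * invKernel (h ω) * invKernel (h ω + 0 * d)) +
          (2 * max (g ω - |h ω|) 0 * d - 0 * d ^ 2) / (1 + |g ω|) ^ 2 + c =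
            slope0 ε (g ω) (h ω) * d + c := by
        simp only [slope0, zero_mul, add_zero, sub_zero]
        ring
      rw [← e4]
      exact e3
    have hED : ∀ n, E n ≤ D n ω := fun n => by
      have hyn := h2 n
      rw [h4 n] at hyn
      have e1 := invKernel_sub_eq (d := d) h3 hyn
      have e2 := le_shortfall_sub (g ω) (d := d) h3 hyn
      have e3 : t n * (ε * (d * invKernel (h ω) * invKernel (h ω + t n * d)) +
          (2 * max (g ω - |h ω|) 0 * d - t n * d ^ 2) / (1 + |g ω|) ^ 2) ≤
          k h ω - k (y n) ω := by
        simp only [k, h4 n]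
        linear_combination (-ε) * e1 + e2
      have := (le_inv_mul_iff₀ (ht0 n)).2 e3
      simp only [E, D]
      linarith
    have e4 := (ENNReal.continuous_ofReal.tendsto _).comp hE
    rw [← e4.liminf_eq]
    exact liminf_le_liminf (Eventually.of_forall fun n => ENNReal.ofReal_le_ofReal (hED n))
  have hfatou : ∫⁻ ω, ENNReal.ofReal (slope0 ε (g ω) (h ω) * (f ω - h ω) + c) ∂P ≤
      ENNReal.ofReal c := by
    refine (lintegral_mono_ae hliminf).trans ?_
    refine (lintegral_liminf_le' fun n =>
      (hDint n).aestronglyMeasurable.aemeasurable.ennreal_ofReal).trans ?_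
    refine (liminf_le_liminf (v := fun _ : ℕ => ENNReal.ofReal c)
      (Eventually.of_forall fun n => ?_)).trans (liminf_const _).le
    rw [← ofReal_integral_eq_lintegral_ofReal (hDint n) (hDnn n)]
    exact ENNReal.ofReal_le_ofReal (hDle n)
  have hsum : ∫⁻ ω, ENNReal.ofReal (slope0 ε (g ω) (h ω) * f ω) ∂P + ENNReal.ofReal c ≤
      ∫⁻ ω, ENNReal.ofReal (slope0 ε (g ω) (h ω) * h ω) ∂P + ENNReal.ofReal c := by
    have hconst : ENNReal.ofReal c = ∫⁻ _, ENNReal.ofReal c ∂P := by simp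
    have hm : Measurable fun ω => ENNReal.ofReal (slope0 ε (g ω) (h ω) * h ω) :=
      ((measurable_slope0_comp ε g h).mul h.measurable).ennreal_ofReal
    calc _ = ∫⁻ ω, (ENNReal.ofReal (slope0 ε (g ω) (h ω) * f ω) + ENNReal.ofReal c) ∂P := by
          rw [lintegral_add_right _ measurable_const, ← hconst]
      _ ≤ ∫⁻ ω, (ENNReal.ofReal (slope0 ε (g ω) (h ω) * h ω) +
            ENNReal.ofReal (slope0 ε (g ω) (h ω) * (f ω - h ω) + c)) ∂P := by
          refine lintegral_mono_ae ?_
          filter_upwards [hK.nonneg f hf] with ω h1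
          rw [← ENNReal.ofReal_add (mul_nonneg (slope0_pos hε _ _).le h1) hc0.le]
          refine le_trans (le_of_eq ?_) ENNReal.ofReal_add_le
          congr 1
          ring
      _ ≤ _ := by
          rw [lintegral_add_left hm]
          gcongr
  exact (ENNReal.add_le_add_iff_right ENNReal.ofReal_ne_top).1 hsum

theorem Admissible.mem_osp_of_minimizer [IsProbabilityMeasure P] {K C : Set (Ω →ₘ[P] ℝ)}
    (hK : Admissible P K) (hCK : C ⊆ K) {ε : ℝ} (hε : 0 < ε) {g h : Ω →ₘ[P] ℝ}
    (hh : h ∈ maxSet P C)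
    (hmin : ∀ f ∈ K,
      ε * meanInv P h + meanShortfall P g h ≤ ε * meanInv P f + meanShortfall P g f) :
    h ∈ osp P C := by
  refine ⟨hh, or_iff_not_imp_left.2 fun hC => ?_⟩
  have hh0 := hK.nonneg h (hCK hh.1)
  have hρ := measurable_slope0_comp ε g h
  have hpair : ∀ f : Ω →ₘ[P] ℝ,
      pairing (P.withDensity fun ω => ENNReal.ofReal (slope0 ε (g ω) (h ω))) f =
        ∫⁻ ω, ENNReal.ofReal (slope0 ε (g ω) (h ω) * f ω) ∂P := fun f => by
    rw [pairing, lintegral_withDensity_eq_lintegral_mul _ hρ.ennreal_ofReal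
      f.measurable.ennreal_ofReal]
    simp only [Pi.mul_apply, ENNReal.ofReal_mul (slope0_pos hε _ _).le]
  refine ⟨P.withDensity fun ω => ENNReal.ofReal (slope0 ε (g ω) (h ω)),
    withDensity_absolutelyContinuous _ _, inferInstance, ?_, ?_, ?_⟩
  · rw [hpair, pos_iff_ne_zero]
    intro h0
    have hm : Measurable fun ω => ENNReal.ofReal (slope0 ε (g ω) (h ω) * h ω) :=
      (hρ.mul h.measurable).ennreal_ofReal
    rw [lintegral_eq_zero_iff hm] at h0
    have hzero : h = 0 := by
      refine AEEqFun.ext ?_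
      filter_upwards [h0, hh0, AEEqFun.coeFn_zero (α := Ω) (β := ℝ) (μ := P)] with ω h1 h2 h3
      rw [h3, Pi.zero_apply]
      have h4 : slope0 ε (g ω) (h ω) * h ω ≤ 0 := ENNReal.ofReal_eq_zero.1 h1
      exact le_antisymm (nonpos_of_mul_nonpos_right h4 (slope0_pos hε _ _)) h2
    refine hC (Subset.antisymm (fun f hf => ?_) (singleton_subset_iff.2 (hzero ▸ hh.1)))
    refine (hh.2 f hf ?_).symm.trans hzero
    rw [hzero]
    refine AEEqFun.coeFn_le.1 ?_
    filter_upwards [hK.nonneg f (hCK hf), AEEqFun.coeFn_zero (α := Ω) (β := ℝ) (μ := P)]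
      with ω h1 h2
    rwa [h2]
  · rw [hpair]
    calc _ ≤ ∫⁻ _, ENNReal.ofReal (ε + 2) ∂P := by
          refine lintegral_mono_ae ?_
          filter_upwards [hh0] with ω h1
          exact ENNReal.ofReal_le_ofReal (slope0_mul_self_le hε _ h1)
      _ < ⊤ := by simp
  · refine le_antisymm (iSup₂_le fun f hf => ?_)
      (le_iSup₂ (f := fun (f : Ω →ₘ[P] ℝ) (_ : f ∈ C) => pairing _ f) h hh.1)
    rw [hpair, hpair]
    exact hK.lintegral_slope_mul_le hε (hCK hh.1) hmin (hCK hf)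

end FirstOrder

section Density

variable {Ω : Type*} [MeasurableSpace Ω] {P : Measure Ω}

theorem eq_of_mem_maxSet_of_le [IsFiniteMeasure P] {C : Set (Ω →ₘ[P] ℝ)}
    (hK : Admissible P (closure0 P C)) (hmaxcl : MaxClosed P C) {g h : Ω →ₘ[P] ℝ}
    (hg : g ∈ maxSet P C) (hh : h ∈ closure0 P C) (hgh : g ≤ h) : h = g := by
  obtain ⟨h', hh', hle⟩ := hK.exists_le_mem_maxSet hh
  exact le_antisymm (hle.trans (hg.2 h' (hmaxcl hh') (hgh.trans hle)).ge) hgh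

theorem meanShortfall_self {g : Ω →ₘ[P] ℝ} (hg : ∀ᵐ ω ∂P, 0 ≤ g ω) :
    meanShortfall P g g = 0 := by
  refine integral_eq_zero_of_ae ?_
  filter_upwards [hg] with ω h
  simp [shortfall, abs_of_nonneg h]

theorem le_of_meanShortfall_eq_zero [IsFiniteMeasure P] {g h : Ω →ₘ[P] ℝ}
    (hh : ∀ᵐ ω ∂P, 0 ≤ h ω) (h0 : meanShortfall P g h = 0) : g ≤ h := by
  have := (integral_eq_zero_iff_of_nonneg (fun ω => shortfall_nonneg (g ω) (h ω))
    (integrable_shortfall g h)).1 h0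
  refine AEEqFun.coeFn_le.1 ?_
  filter_upwards [this, hh] with ω h1 h2
  have h3 : (max (g ω - |h ω|) 0 / (1 + |g ω|)) ^ 2 = 0 := h1
  rw [sq_eq_zero_iff, div_eq_zero_iff, or_iff_left (one_add_abs_pos _).ne', abs_of_nonneg h2] at h3
  linarith [le_max_left (g ω - h ω) 0]

theorem exists_seq_osp_tendsto [IsProbabilityMeasure P] {C : Set (Ω →ₘ[P] ℝ)}
    (hK : Admissible P (closure0 P C)) (hmaxcl : MaxClosed P C) {g : Ω →ₘ[P] ℝ}
    (hg : g ∈ maxSet P C) :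
    ∃ h : ℕ → Ω →ₘ[P] ℝ, (∀ n, h n ∈ osp P C) ∧ Tendsto0 P h g := by
  have hCK := subset_closure0 (P := P) C
  set ε : ℕ → ℝ := fun n => 1 / ((n : ℝ) + 1) with hεdef
  have hε : ∀ n, 0 < ε n := fun n => Nat.one_div_pos_of_nat
  have hεlim : Tendsto ε atTop (nhds 0) := tendsto_one_div_add_atTop_nhds_zero_nat
  choose h hhK hmin using fun n => hK.exists_minimizer ⟨g, hCK hg.1⟩ (hε n) g
  have hosp : ∀ n, h n ∈ osp P C := fun n => by
    have hm := hK.mem_maxSet_of_minimizer (hε n) (hhK n) (hmin n)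
    exact hK.mem_osp_of_minimizer hCK (hε n)
      ⟨hmaxcl hm, fun f hf hle => hm.2 f (hCK hf) hle⟩ (hmin n)
  have hJ : Monotone fun n => meanInv P (h n) := by
    intro n m hnm
    rcases hnm.eq_or_lt with rfl | hlt
    · exact le_rfl
    have h1 := hmin n _ (hhK m)
    have h2 := hmin m _ (hhK n)
    have h3 : ε m < ε n := Nat.one_div_lt_one_div hlt
    have h4 : (ε n - ε m) * meanInv P (h n) ≤ (ε n - ε m) * meanInv P (h m) := by linarith
    exact le_of_mul_le_mul_left h4 (sub_pos.2 h3)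
  have hgap : ∀ n m, n ≤ m →
      ∫ ω, (invKernel (h n ω) - invKernel (h m ω)) ^ 2 ∂P ≤
        2 * (meanInv P (h m) - meanInv P (h n)) := by
    intro n m hnm
    have h1 := meanInv_midpoint_le (hK.nonneg _ (hhK n)) (hK.nonneg _ (hhK m))
    have h2 := meanShortfall_midpoint_le g (hK.nonneg _ (hhK n)) (hK.nonneg _ (hhK m))
    have h3 := hmin n _ (hK.convex (hhK n) (hhK m) (by norm_num : (0 : ℝ) ≤ 1 / 2)
      (by norm_num : (0 : ℝ) ≤ 1 / 2) (by norm_num))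
    have h4 := hmin m _ (hhK n)
    have h5 := mul_le_mul_of_nonneg_left (hJ hnm) (hε m).le
    have h6 := mul_le_mul_of_nonneg_left h1 (hε n).le
    refine le_of_mul_le_mul_left ?_ (hε n)
    simp only at h5
    linarith
  obtain ⟨b, hb⟩ : ∃ b, Tendsto (fun n => meanInv P (h n)) atTop (nhds b) :=
    ⟨_, tendsto_atTop_ciSup hJ ⟨1, by rintro _ ⟨n, rfl⟩; exact meanInv_le_one _⟩⟩
  obtain ⟨φ, hφ, hφb⟩ := extraction_forall_of_eventually
    (P := fun N n => b - 1 / 2 * ((1 / 4 : ℝ) ^ N) ^ 2 < meanInv P (h n)) fun N =>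
      hb.eventually (lt_mem_nhds (sub_lt_self b (by positivity)))
  have hcau : ∀ N n m, N ≤ n → n ≤ m →
      ∫ ω, (invKernel (h (φ n) ω) - invKernel (h (φ m) ω)) ^ 2 ∂P ≤ ((1 / 4 : ℝ) ^ N) ^ 2 := by
    intro N n m hn hm
    have h1 := hgap _ _ (hφ.monotone hm)
    have h2 := hJ (hφ.monotone hn)
    have h3 := hJ.ge_of_tendsto hb (φ m)
    have h4 := hφb N
    simp only at h2 h3
    linarith
  obtain ⟨h', hh'K, hlim⟩ := hK.exists_ae_tendsto (fun n => hhK (φ n)) fun N n m hn hm => by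
    rcases le_total n m with hnm | hnm
    · exact hcau N n m hn hnm
    · simpa only [sub_sq_comm] using hcau N m n hm hnm
  have hA : meanShortfall P g h' = 0 := by
    refine le_antisymm ?_ (meanShortfall_nonneg _ _)
    refine le_of_tendsto_of_tendsto' (tendsto_meanShortfall g hlim)
      (hεlim.comp hφ.tendsto_atTop) fun n => ?_
    have h1 := hmin (φ n) g (hCK hg.1)
    rw [meanShortfall_self (hK.nonneg g (hCK hg.1))] at h1
    have h2 := mul_le_mul_of_nonneg_left (meanInv_le_one g) (hε (φ n)).le
    have h3 := mul_nonneg (hε (φ n)).le (meanInv_nonneg (h (φ n)))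
    simp only [Function.comp_apply]
    linarith
  have heq := eq_of_mem_maxSet_of_le hK hmaxcl hg hh'K
    (le_of_meanShortfall_eq_zero (hK.nonneg h' hh'K) hA)
  subst heq
  exact ⟨fun n => h (φ n), fun n => hosp _, tendsto_dist0_of_ae_tendsto hlim⟩

end Density

/-- Bishop-Phelps type theorem. If `C ⊆ L⁰₊` is convex, max-closed and
bounded, then `C^osp` is nonempty and `C^osp` is dense in `C^max` (every element of `C^max`
is the limit in probability of a sequence of outer support points of `C`). -/
theorem statement1 {Ω : Type*} [MeasurableSpace Ω] (P : Measure Ω) [IsProbabilityMeasure P]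
    (C : Set (Ω →ₘ[P] ℝ)) (hCL0 : C ⊆ L0plus P) (hCne : C.Nonempty)
    (hconv : Convex ℝ C) (hmaxcl : MaxClosed P C) (hbdd : Bounded0 P C) :
    (osp P C).Nonempty ∧
      ∀ g ∈ maxSet P C, ∃ h : ℕ → Ω →ₘ[P] ℝ, (∀ n, h n ∈ osp P C) ∧ Tendsto0 P h g := by
  have hK := admissible_closure0 hCL0 hconv hbdd
  refine ⟨?_, fun g hg => exists_seq_osp_tendsto hK hmaxcl hg⟩
  obtain ⟨f, hf⟩ := hCne
  obtain ⟨g, hg, -⟩ := hK.exists_le_mem_maxSet (subset_closure0 C hf)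
  obtain ⟨h, hh, -⟩ := exists_seq_osp_tendsto hK hmaxcl (g := g)
    ⟨hmaxcl hg, fun f' hf' hle => hg.2 f' (subset_closure0 C hf') hle⟩
  exact ⟨h 0, hh 0⟩
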